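/- Let A = (|e_1⟩⟨e_1|,…,|e_N⟩⟨e_N|) be an extremal rank-one N-valued observable in ℂ^h with N = h + 1, and let B = (|f_1⟩⟨f_1|,…,|f_N⟩⟨f_N|) be an extremal rank-one N-valued observable in ℂ^k. Then the direct sum A ⊕ B, an N-valued observable in ℂ^h ⊕ ℂ^k, is extremal. -/

import Mathlib

open Matrix
open scoped ComplexOrder

/-- An `ι`-valued observable in `ℂ^n`: a family of positive semidefinite matrices
summing to the identity. -/
def IsObservable {ι n : Type*} [Fintype ι] [Fintype n] [DecidableEq n]
    (A : ι → Matrix n n ℂ) : Prop :=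
  (∀ i, (A i).PosSemidef) ∧ ∑ i, A i = 1

/-- An observable is extremal if it is an extreme point of the convex set of observables. -/
def IsExtremalObservable {ι n : Type*} [Fintype ι] [Fintype n] [DecidableEq n]
    (A : ι → Matrix n n ℂ) : Prop :=
  A ∈ Set.extremePoints ℝ {B : ι → Matrix n n ℂ | IsObservable B}

/-- A vector annihilated by the upper left block of a positive semidefinite block matrix is
annihilated by the lower left block. -/
theorem Matrix.PosSemidef.mulVec_toBlocks₂₁_eq_zero {m n : Type*} [Fintype m] [Fintype n]
    {M : Matrix (m ⊕ n) (m ⊕ n) ℂ} (hM : M.PosSemidef) {v : m → ℂ}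
    (hv : M.toBlocks₁₁ *ᵥ v = 0) : M.toBlocks₂₁ *ᵥ v = 0 := by
  have key : M *ᵥ Sum.elim v 0 = Sum.elim (M.toBlocks₁₁ *ᵥ v) (M.toBlocks₂₁ *ᵥ v) := by
    conv_lhs => rw [← fromBlocks_toBlocks M, fromBlocks_mulVec]
    simp
  have h0 : M *ᵥ Sum.elim v 0 = 0 := by
    rw [← hM.dotProduct_mulVec_zero_iff, key, hv]
    simp [dotProduct]
  rw [key] at h0
  funext j
  simpa using congrFun h0 (Sum.inr j)

/-- A vector annihilated by the lower right block of a positive semidefinite block matrix is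
annihilated by the upper right block. -/
theorem Matrix.PosSemidef.mulVec_toBlocks₁₂_eq_zero {m n : Type*} [Fintype m] [Fintype n]
    {M : Matrix (m ⊕ n) (m ⊕ n) ℂ} (hM : M.PosSemidef) {v : n → ℂ}
    (hv : M.toBlocks₂₂ *ᵥ v = 0) : M.toBlocks₁₂ *ᵥ v = 0 :=
  (hM.submatrix Sum.swap).mulVec_toBlocks₂₁_eq_zero (v := v) hv

/-- A matrix that vanishes on the orthogonal complement of `e` has rank at most one, with row
direction `star e`. -/
theorem exists_eq_vecMulVec_star {m n : Type*} [Fintype m] [DecidableEq m]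
    {C : Matrix n m ℂ} {e : m → ℂ} (he : e ≠ 0)
    (hC : ∀ v, vecMulVec e (star e) *ᵥ v = 0 → C *ᵥ v = 0) :
    ∃ u, C = vecMulVec u (star e) := by
  have hs : star e ⬝ᵥ e ≠ 0 := by simpa using he
  refine ⟨(star e ⬝ᵥ e)⁻¹ • (C *ᵥ e), ?_⟩
  ext i j
  have h := congrFun (hC (Pi.single j 1 - ((star e ⬝ᵥ e)⁻¹ * star (e j)) • e) (by
    rw [mulVec_sub, mulVec_smul, vecMulVec_mulVec, vecMulVec_mulVec]
    ext p
    simp only [dotProduct_single, Pi.sub_apply, Pi.smul_apply, Pi.star_apply,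
      MulOpposite.smul_eq_mul_unop, MulOpposite.unop_op, smul_eq_mul, Pi.zero_apply]
    field_simp
    ring)) i
  rw [mulVec_sub, mulVec_smul] at h
  simp only [mulVec_single_one, Pi.sub_apply, Pi.smul_apply, smul_eq_mul, col_apply,
    Pi.zero_apply] at h
  simp only [vecMulVec_apply, Pi.smul_apply, smul_eq_mul, Pi.star_apply]
  linear_combination h

/-- The off-diagonal block of a positive semidefinite block matrix with rank-one diagonal blocks
`|e⟩⟨e|` and `|f⟩⟨f|` is a multiple of `|e⟩⟨f|`. -/
theorem Matrix.PosSemidef.exists_toBlocks₁₂_eq_smul {m n : Type*} [Fintype m] [Fintype n]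
    [DecidableEq m] [DecidableEq n]
    {M : Matrix (m ⊕ n) (m ⊕ n) ℂ} (hM : M.PosSemidef) {e : m → ℂ} {f : n → ℂ}
    (he : e ≠ 0) (hf : f ≠ 0) (h₁ : M.toBlocks₁₁ = vecMulVec e (star e))
    (h₂ : M.toBlocks₂₂ = vecMulVec f (star f)) :
    ∃ c : ℂ, M.toBlocks₁₂ = c • vecMulVec e (star f) := by
  obtain ⟨u, hu⟩ := exists_eq_vecMulVec_star (C := M.toBlocks₂₁) he fun v hv =>
    hM.mulVec_toBlocks₂₁_eq_zero (by rwa [h₁])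
  obtain ⟨w, hw⟩ := exists_eq_vecMulVec_star (C := M.toBlocks₁₂) hf fun v hv =>
    hM.mulVec_toBlocks₁₂_eq_zero (by rwa [h₂])
  obtain ⟨q, hq⟩ := Function.ne_iff.mp hf
  have hq' : star (f q) ≠ 0 := by simpa using hq
  have hcomm : ∀ i, w i * star (f q) = star (u q) * e i := fun i => by
    have a := congrFun₂ hu q i
    have b := congrFun₂ hw i q
    have c : star (M (Sum.inr q) (Sum.inl i)) = M (Sum.inl i) (Sum.inr q) :=
      hM.isHermitian.apply _ _
    simp only [toBlocks₂₁, toBlocks₁₂, of_apply, vecMulVec_apply, Pi.star_apply] at a b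
    rw [← b, ← c, a, star_mul', star_star]
  refine ⟨star (u q) / star (f q), ?_⟩
  rw [hw]
  ext i j
  simp only [vecMulVec_apply, Matrix.smul_apply, smul_eq_mul, Pi.star_apply]
  have hw' : w i = star (u q) / star (f q) * e i := by
    rw [div_mul_eq_mul_div, eq_div_iff hq', hcomm]
  rw [hw', mul_assoc]

/-- The effects of an extremal observable with nonzero effects are linearly independent over
the reals. -/
theorem IsExtremalObservable.linearIndependent {ι n : Type*} [Fintype ι] [Fintype n]
    [DecidableEq n] {A : ι → Matrix n n ℂ} (hA : IsExtremalObservable A) (hA0 : ∀ i, A i ≠ 0) :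
    LinearIndependent ℝ A := by
  rw [Fintype.linearIndependent_iff]
  intro r hr i
  set K : ℝ := 1 + ∑ j, |r j|
  have hKpos : 0 < K := by positivity
  have hle : ∀ j, |r j / K| ≤ 1 := fun j => by
    rw [abs_div, abs_of_pos hKpos, div_le_one hKpos]
    have := Finset.single_le_sum (f := fun j => |r j|) (fun _ _ => abs_nonneg _)
      (Finset.mem_univ j)
    linarith
  have hsum : ∑ j, (r j / K) • A j = 0 := by
    simp_rw [div_eq_inv_mul, mul_smul, ← Finset.smul_sum, hr, smul_zero]
  have hpert : ∀ s : ℝ, |s| = 1 → IsObservable fun j => (1 + s * (r j / K)) • A j := by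
    intro s hs
    refine ⟨fun j => (hA.1.1 j).smul ?_, ?_⟩
    · have := neg_abs_le (s * (r j / K))
      rw [abs_mul, hs, one_mul] at this
      linarith [hle j]
    · simp_rw [add_smul, one_smul, mul_smul, Finset.sum_add_distrib, ← Finset.smul_sum, hsum,
        smul_zero, add_zero]
      exact hA.1.2
  have heq := ((mem_extremePoints_iff_left).1 hA).2 _ (hpert 1 (by simp)) _ (hpert (-1) (by simp))
    ⟨1 / 2, 1 / 2, by norm_num, by norm_num, by norm_num, by
      funext j
      simp only [Pi.add_apply, Pi.smul_apply, smul_smul, ← add_smul]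
      ring_nf
      simp⟩
  have hi := congrFun heq i
  simp only [one_mul, add_smul, one_smul, add_eq_left, smul_eq_zero, hA0 i, or_false,
    div_eq_zero_iff, hKpos.ne'] at hi
  exact hi

/-- If `h + 1` vectors span `ℂ^h`, then the space of their linear relations is a line. -/
theorem exists_smul_eq_of_sum_smul_eq_zero {ι m : Type*} [Fintype ι] [Fintype m] [DecidableEq m]
    (hcard : Fintype.card ι = Fintype.card m + 1) {e : ι → m → ℂ}
    (he : ∑ i, vecMulVec (e i) (star (e i)) = 1) {v w : ι → ℂ} (hv0 : v ≠ 0)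
    (hv : ∑ i, v i • e i = 0) (hw : ∑ i, w i • e i = 0) : ∃ c : ℂ, c • v = w := by
  let T := Fintype.linearCombination ℂ e
  have hT : LinearMap.range T = ⊤ := by
    rw [LinearMap.range_eq_top]
    intro x
    refine ⟨fun i => star (e i) ⬝ᵥ x, ?_⟩
    have h := congrArg (· *ᵥ x) he
    simp only [sum_mulVec, vecMulVec_mulVec, one_mulVec] at h
    simpa [T, Fintype.linearCombination_apply] using h
  have hrank := T.finrank_range_add_finrank_ker
  rw [hT, finrank_top, Module.finrank_fintype_fun_eq_card, Module.finrank_fintype_fun_eq_card,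
    hcard, Nat.add_left_cancel_iff] at hrank
  have hvT : v ∈ LinearMap.ker T := by simpa [T, Fintype.linearCombination_apply] using hv
  have hwT : w ∈ LinearMap.ker T := by simpa [T, Fintype.linearCombination_apply] using hw
  obtain ⟨c, hc⟩ := exists_smul_eq_of_finrank_eq_one hrank (x := ⟨v, hvT⟩)
    (by simpa [Subtype.ext_iff] using hv0) ⟨w, hwT⟩
  exact ⟨c, congrArg Subtype.val hc⟩

/-- Let `h + 1` nonzero vectors `e i` resolve the identity of `ℂ^h`, and let the projections
`|f i⟩⟨f i|` be linearly independent over the reals. Then a vanishing linear combination of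
the operators `|e i⟩⟨f i|` is trivial. -/
theorem eq_zero_of_sum_smul_vecMulVec_eq_zero {ι m n : Type*} [Fintype ι] [Fintype m]
    [DecidableEq m] (hcard : Fintype.card ι = Fintype.card m + 1)
    {e : ι → m → ℂ} {f : ι → n → ℂ} (he0 : ∀ i, e i ≠ 0)
    (he : ∑ i, vecMulVec (e i) (star (e i)) = 1)
    (hf : LinearIndependent ℝ fun i => vecMulVec (f i) (star (f i)))
    {c : ι → ℂ} (hc : ∑ i, c i • vecMulVec (e i) (star (f i)) = 0) (i : ι) : c i = 0 := by
  have hf0 : ∀ j, f j ≠ 0 := fun j hj => hf.ne_zero j (by simp [hj])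
  have hrel : ∀ q, ∑ j, (c j * star (f j q)) • e j = 0 := fun q => by
    ext p
    have := congrFun₂ hc p q
    simp only [Matrix.sum_apply, Matrix.smul_apply, vecMulVec_apply, Pi.star_apply, smul_eq_mul,
      Matrix.zero_apply] at this
    simp only [Finset.sum_apply, Pi.smul_apply, smul_eq_mul, Pi.zero_apply]
    rw [← this]
    exact Finset.sum_congr rfl fun j _ => by ring
  by_contra hci
  obtain ⟨p, hp⟩ := Function.ne_iff.mp (hf0 i)
  have hp' : star (f i p) ≠ 0 := by simpa using hp
  have hv0 : (fun j => c j * star (f j p)) ≠ 0 :=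
    Function.ne_iff.mpr ⟨i, mul_ne_zero hci hp'⟩
  choose g hg using fun q => exists_smul_eq_of_sum_smul_eq_zero hcard he hv0 (hrel p) (hrel q)
  have hfg : ∀ j, c j ≠ 0 → ∀ q, f j q = star (g q) * f j p := fun j hj q => by
    have h := congrFun (hg q) j
    simp only [Pi.smul_apply, smul_eq_mul] at h
    have h' : star (f j q) = g q * star (f j p) := by
      apply mul_left_cancel₀ hj
      rw [← h]
      ring
    rw [← star_star (f j q), h', star_mul', star_star]
  have hother : ∀ j, j ≠ i → c j = 0 := fun j hji => by
    by_contra hj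
    have hdep : Complex.normSq (f j p) • vecMulVec (f i) (star (f i)) =
        Complex.normSq (f i p) • vecMulVec (f j) (star (f j)) := by
      ext a b
      simp only [Matrix.smul_apply, vecMulVec_apply, Pi.star_apply, Complex.real_smul,
        Complex.normSq_eq_conj_mul_self]
      rw [hfg i hci a, hfg i hci b, hfg j hj a, hfg j hj b]
      simp only [star_mul', Complex.star_def]
      ring
    have hzero := ((LinearIndepOn.pair_iff _ hji.symm).1 (hf.linearIndepOn {i, j}) _
      (-Complex.normSq (f i p)) (by rw [hdep, neg_smul, add_neg_cancel])).2
    exact hp (by simpa using hzero)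
  have h := hrel p
  rw [Finset.sum_eq_single i (fun j _ hji => by rw [hother j hji, zero_mul, zero_smul])
    (fun h => absurd (Finset.mem_univ i) h)] at h
  exact smul_ne_zero (mul_ne_zero hci hp') (he0 i) h

theorem IsObservable.toBlocks₁₁ {ι m n : Type*} [Fintype ι] [Fintype m] [Fintype n]
    [DecidableEq m] [DecidableEq n] {X : ι → Matrix (m ⊕ n) (m ⊕ n) ℂ} (hX : IsObservable X) :
    IsObservable fun i => (X i).toBlocks₁₁ := by
  refine ⟨fun i => (hX.1 i).submatrix Sum.inl, ?_⟩
  ext a b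
  simpa [Matrix.sum_apply, Matrix.toBlocks₁₁, one_apply] using congrFun₂ hX.2 (Sum.inl a) (Sum.inl b)

theorem IsObservable.toBlocks₂₂ {ι m n : Type*} [Fintype ι] [Fintype m] [Fintype n]
    [DecidableEq m] [DecidableEq n] {X : ι → Matrix (m ⊕ n) (m ⊕ n) ℂ} (hX : IsObservable X) :
    IsObservable fun i => (X i).toBlocks₂₂ := by
  refine ⟨fun i => (hX.1 i).submatrix Sum.inr, ?_⟩
  ext a b
  simpa [Matrix.sum_apply, Matrix.toBlocks₂₂, one_apply] using congrFun₂ hX.2 (Sum.inr a) (Sum.inr b)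

theorem IsObservable.sum_toBlocks₁₂ {ι m n : Type*} [Fintype ι] [Fintype m] [Fintype n]
    [DecidableEq m] [DecidableEq n] {X : ι → Matrix (m ⊕ n) (m ⊕ n) ℂ} (hX : IsObservable X) :
    ∑ i, (X i).toBlocks₁₂ = 0 := by
  ext a b
  simpa [Matrix.sum_apply, Matrix.toBlocks₁₂, one_apply] using congrFun₂ hX.2 (Sum.inl a) (Sum.inr b)

theorem IsObservable.fromBlocks {ι m n : Type*} [Fintype ι] [Fintype m] [Fintype n]
    [DecidableEq m] [DecidableEq n] {A : ι → Matrix m m ℂ} {B : ι → Matrix n n ℂ}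
    (hA : IsObservable A) (hB : IsObservable B) :
    IsObservable fun i => Matrix.fromBlocks (A i) 0 0 (B i) := by
  refine ⟨fun i => ?_, ?_⟩
  · refine .of_dotProduct_mulVec_nonneg
      (.fromBlocks (hA.1 i).isHermitian (by simp) (hB.1 i).isHermitian) fun x => ?_
    rw [fromBlocks_mulVec]
    have h := add_nonneg ((hA.1 i).dotProduct_mulVec_nonneg (x ∘ Sum.inl))
      ((hB.1 i).dotProduct_mulVec_nonneg (x ∘ Sum.inr))
    simpa [dotProduct, Fintype.sum_sum_type] using h
  · ext (a | a) (b | b)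
    · simpa [Matrix.sum_apply, one_apply] using congrFun₂ hA.2 a b
    · simp [Matrix.sum_apply]
    · simp [Matrix.sum_apply]
    · simpa [Matrix.sum_apply, one_apply] using congrFun₂ hB.2 a b

/-- The direct sum of an extremal rank-one `(h+1)`-valued observable in `ℂ^h` with any
extremal rank-one observable is extremal. -/
theorem stmt_15 {N h k : ℕ} (hN : N = h + 1)
    (e : Fin N → Fin h → ℂ) (f : Fin N → Fin k → ℂ)
    (he0 : ∀ i, e i ≠ 0) (hf0 : ∀ i, f i ≠ 0)
    (he : ∑ i, vecMulVec (e i) (star (e i)) = 1)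
    (hf : ∑ i, vecMulVec (f i) (star (f i)) = 1)
    (hAex : IsExtremalObservable fun i => vecMulVec (e i) (star (e i)))
    (hBex : IsExtremalObservable fun i => vecMulVec (f i) (star (f i))) :
    IsExtremalObservable fun i =>
      Matrix.fromBlocks (vecMulVec (e i) (star (e i))) 0 0
        (vecMulVec (f i) (star (f i))) := by
  refine mem_extremePoints_iff_left.2 ⟨hAex.1.fromBlocks hBex.1, ?_⟩
  rintro X hX Y hY ⟨a, b, ha, hb, hab, hXY⟩
  have hX₁ := (mem_extremePoints_iff_left.1 hAex).2 _ hX.toBlocks₁₁ _ hY.toBlocks₁₁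
    ⟨a, b, ha, hb, hab, by
      funext i
      ext p q
      simpa [toBlocks₁₁] using congrFun₂ (congrFun hXY i) (Sum.inl p) (Sum.inl q)⟩
  have hX₂ := (mem_extremePoints_iff_left.1 hBex).2 _ hX.toBlocks₂₂ _ hY.toBlocks₂₂
    ⟨a, b, ha, hb, hab, by
      funext i
      ext p q
      simpa [toBlocks₂₂] using congrFun₂ (congrFun hXY i) (Sum.inr p) (Sum.inr q)⟩
  choose c hc using fun i => (hX.1 i).exists_toBlocks₁₂_eq_smul (he0 i) (hf0 i)
    (congrFun hX₁ i) (congrFun hX₂ i)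
  have hsum := hX.sum_toBlocks₁₂
  simp_rw [hc] at hsum
  have hc0 := eq_zero_of_sum_smul_vecMulVec_eq_zero (by simpa using hN) he0 he
    (hBex.linearIndependent fun i => by simpa [vecMulVec_eq_zero] using hf0 i) hsum
  funext i
  have hR : (X i).toBlocks₁₂ = 0 := by rw [hc, hc0, zero_smul]
  have hS : (X i).toBlocks₂₁ = 0 := by
    ext p q
    have h : star (X i (Sum.inl q) (Sum.inr p)) = X i (Sum.inr p) (Sum.inl q) :=
      (hX.1 i).isHermitian.apply _ _
    have h' : X i (Sum.inl q) (Sum.inr p) = 0 := congrFun₂ hR q p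
    rw [h', star_zero] at h
    exact h.symm
  rw [← fromBlocks_toBlocks (X i), congrFun hX₁ i, congrFun hX₂ i, hR, hS]
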